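/- Right cross-correlation theorem: for every representation ρ of the finite group G, the group Fourier transform of the right cross-correlation m ⋆_R x at ρ satisfies (m ⋆_R x)^(ρ) = x̂(ρ) · (∑_{v ∈ G} m(v) ρ(v)⁻¹). In particular, if ρ is unitary and m is real-valued, then (m ⋆_R x)^(ρ) = x̂(ρ) · m̂(ρ)ᴴ. -/

import Mathlib

open scoped BigOperators ComplexConjugate Matrix

/-- Right group cross-correlation: `(m ⋆_R x)(u) = ∑_{v ∈ G} m(u⁻¹ v) x(v)`. -/
noncomputable def groupCrossCorrR {G : Type*} [Group G] [Fintype G] (m x : G → ℂ) : G → ℂ :=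
  fun u => ∑ v : G, m (u⁻¹ * v) * x v

/-- Group Fourier transform of `f : G → ℂ` at a matrix-valued representation `ρ`:
`f̂(ρ) = ∑_{u ∈ G} f(u) ρ(u)`. -/
noncomputable def groupFourier {G : Type*} [Group G] [Fintype G] {d : ℕ}
    (f : G → ℂ) (ρ : G → Matrix (Fin d) (Fin d) ℂ) : Matrix (Fin d) (Fin d) ℂ :=
  ∑ u : G, f u • ρ u

/-- The value of a matrix representation at `g⁻¹` is the matrix inverse of its value at `g`. -/
theorem inv_apply_of_map_mul {G : Type*} [Group G] {d : ℕ} {ρ : G → Matrix (Fin d) (Fin d) ℂ}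
    (hρ : ∀ g₁ g₂ : G, ρ g₁ * ρ g₂ = ρ (g₁ * g₂)) (hρ1 : ρ 1 = 1) (g : G) :
    (ρ g)⁻¹ = ρ g⁻¹ :=
  Matrix.inv_eq_right_inv (by rw [hρ, mul_inv_cancel, hρ1])

theorem fourier_groupCrossCorrR {G : Type*} [Group G] [Fintype G] {d : ℕ}
    (m x : G → ℂ) (ρ : G → Matrix (Fin d) (Fin d) ℂ)
    (hρ : ∀ g₁ g₂ : G, ρ g₁ * ρ g₂ = ρ (g₁ * g₂)) (hρ1 : ρ 1 = 1) :
    groupFourier (groupCrossCorrR m x) ρ = groupFourier x ρ * (∑ v : G, m v • (ρ v)⁻¹) ∧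
    ((∀ g : G, (ρ g)ᴴ * ρ g = 1) → (∀ g : G, (m g).im = 0) →
      groupFourier (groupCrossCorrR m x) ρ = groupFourier x ρ * (groupFourier m ρ)ᴴ) := by
  have general : groupFourier (groupCrossCorrR m x) ρ =
      groupFourier x ρ * (∑ v : G, m v • (ρ v)⁻¹) := by
    simp only [groupFourier, groupCrossCorrR, Finset.sum_smul]
    rw [Finset.sum_comm, Finset.sum_mul_sum]
    refine Finset.sum_congr rfl fun v _ => ?_
    refine Fintype.sum_equiv ((Equiv.inv G).trans (Equiv.mulRight v)) _ _ fun u => ?_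
    simp only [Equiv.trans_apply, Equiv.inv_apply, Equiv.coe_mulRight]
    rw [inv_apply_of_map_mul hρ hρ1, smul_mul_smul_comm, hρ, mul_comm (x v)]
    simp
  refine ⟨general, fun hunitary hreal => ?_⟩
  rw [general, groupFourier, groupFourier, Matrix.conjTranspose_sum]
  congr 1
  refine Finset.sum_congr rfl fun v _ => ?_
  rw [Matrix.conjTranspose_smul, Matrix.inv_eq_left_inv (hunitary v)]
  congr 1
  exact (Complex.conj_eq_iff_im.mpr (hreal v)).symm
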